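/- Let d ≥ 1, p > 0 and −∞ < γ < β < α < 2. Then 𝔗_{γ→α,p} = 𝔗_{β→α,p} ∘ 𝔗_{γ→β,p}: the domains coincide, i.e. 𝔇(𝔗_{γ→α,p}) = {M ∈ 𝔇(𝔗_{γ→β,p}) : 𝔗_{γ→β,p}M ∈ 𝔇(𝔗_{β→α,p})}, and for every M in this common domain one has 𝔗_{β→α,p}(𝔗_{γ→β,p} M) = 𝔗_{γ→α,p} M as measures on ℝ^d. -/

import Mathlib

open MeasureTheory Set

noncomputable section

variable {E : Type*} [NormedAddCommGroup E] [NormedSpace ℝ E]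
  [MeasurableSpace E] [BorelSpace E]

/-- The upsilon transform with dilation measure `ρ` on `(0,∞) ⊆ ℝ`:
`[Υ_ρ M](B) = ∫ M(s⁻¹ B) ρ(ds)`, realized as the image of `ρ ⊗ M` under `(s, x) ↦ s • x`. -/
def Upsilon (ρ : Measure ℝ) (M : Measure E) : Measure E :=
  Measure.map (fun sx : ℝ × E => sx.1 • sx.2) (ρ.prod M)

/-- `M` is a Lévy measure: σ-finite, no mass at `0`, and `∫ (|x|² ∧ 1) M(dx) < ∞`. -/
def IsLevyMeasure (M : Measure E) : Prop :=
  SigmaFinite M ∧ M {0} = 0 ∧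
    ∫⁻ x, ENNReal.ofReal (min (‖x‖ ^ 2) 1) ∂M < ⊤

/-- The domain `𝔇(Υ_ρ)`: Lévy measures `M` such that `Υ_ρ M` is again a Lévy measure. -/
def UpsilonDomain (ρ : Measure ℝ) : Set (Measure E) :=
  {M | IsLevyMeasure M ∧ IsLevyMeasure (Upsilon ρ M)}

/-- The range `ℜ(Υ_ρ) = {Υ_ρ M : M ∈ 𝔇(Υ_ρ)}`. -/
def UpsilonRange (ρ : Measure ℝ) : Set (Measure E) :=
  Upsilon ρ '' UpsilonDomain (E := E) ρ

/-- The class `𝔐^α`: Borel measures with `M({0}) = 0` and `∫ (|x|² ∧ |x|^α) M(dx) < ∞`. -/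
def MemMAlpha (α : ℝ) (M : Measure E) : Prop :=
  M {0} = 0 ∧ ∫⁻ x, ENNReal.ofReal (min (‖x‖ ^ 2) (‖x‖ ^ α)) ∂M < ⊤

/-- The class `𝔐^log`: Lévy measures with `∫_{|x|>1} log|x| M(dx) < ∞`. -/
def MemMLog (M : Measure E) : Prop :=
  IsLevyMeasure M ∧
    ∫⁻ x in {x : E | 1 < ‖x‖}, ENNReal.ofReal (Real.log ‖x‖) ∂M < ⊤

/-- The dilation measure `ψ_{α,p}(ds) = s^{-α-1} e^{-s^p} 1_{s>0} ds`. -/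
def psiMeasure (α p : ℝ) : Measure ℝ :=
  (volume : Measure ℝ).withDensity fun s =>
    if 0 < s then ENNReal.ofReal (s ^ (-α - 1) * Real.exp (-(s ^ p))) else 0

/-- `K_{α,β,p} = ∫₀^∞ u^{α-β-1} e^{-u^p} du`. -/
def Kconst (α β p : ℝ) : ℝ :=
  ∫ u in Ioi (0 : ℝ), u ^ (α - β - 1) * Real.exp (-(u ^ p))

/-- The dilation measure
`τ_{β→α,p}(ds) = K_{α,β,p}⁻¹ s^{-α-1} (1-s^p)^{(α-β)/p - 1} 1_{0<s<1} ds`. -/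
def tauMeasure (β α p : ℝ) : Measure ℝ :=
  (volume : Measure ℝ).withDensity fun s =>
    if 0 < s ∧ s < 1 then
      ENNReal.ofReal ((Kconst α β p)⁻¹ * (s ^ (-α - 1) * (1 - s ^ p) ^ ((α - β) / p - 1)))
    else 0

/-- `f` is the density of the fully right-skewed `r`-stable distribution on `(0,∞)`:
a nonnegative measurable function with `∫₀^∞ e^{-t x} f(x) dx = e^{-t^r}` for all `t ≥ 0`. -/
def IsStableDensity (r : ℝ) (f : ℝ → ℝ) : Prop :=
  Measurable f ∧ (∀ x, 0 ≤ f x) ∧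
    ∀ t : ℝ, 0 ≤ t →
      ∫ x in Ioi (0 : ℝ), Real.exp (-(t * x)) * f x = Real.exp (-(t ^ r))

/-- The dilation measure `π_{α,p→q}(ds) = p f_{q/p}(s^{-p}) s^{-α-p-1} 1_{s>0} ds`,
where `f` is (to be assumed) the density of the fully right-skewed `q/p`-stable law. -/
def piMeasure (f : ℝ → ℝ) (α p : ℝ) : Measure ℝ :=
  (volume : Measure ℝ).withDensity fun s =>
    if 0 < s then ENNReal.ofReal (p * f (s ^ (-p)) * s ^ (-α - p - 1)) else 0

/-- The measure `ρ(ds) = g(s) 1_{s>0} ds`. -/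
def densMeasure (g : ℝ → ℝ) : Measure ℝ :=
  (volume : Measure ℝ).withDensity fun s => if 0 < s then ENNReal.ofReal (g s) else 0

open ProbabilityTheory (beta beta_pos)

lemma lintegral_Ioo_rpow_mul_one_sub_rpow {a b : ℝ} (ha : 0 < a) (hb : 0 < b) :
    ∫⁻ v in Ioo (0 : ℝ) 1, ENNReal.ofReal (v ^ (a - 1) * (1 - v) ^ (b - 1)) =
      ENNReal.ofReal (beta a b) := by
  have hB := beta_pos ha hb
  have h := ProbabilityTheory.lintegral_betaPDF_eq_one ha hb
  rw [ProbabilityTheory.lintegral_betaPDF] at h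
  have h' : ∀ v : ℝ, ENNReal.ofReal (v ^ (a - 1) * (1 - v) ^ (b - 1)) =
      ENNReal.ofReal (beta a b) *
        ENNReal.ofReal (1 / beta a b * v ^ (a - 1) * (1 - v) ^ (b - 1)) := by
    intro v
    rw [← ENNReal.ofReal_mul hB.le]
    congr 1
    field_simp
  simp_rw [h']
  rw [lintegral_const_mul' _ _ ENNReal.ofReal_ne_top, h, mul_one]

/-- The beta integral over `(r, 1)` after the substitution `v = (t ^ p - r ^ p) / (1 - r ^ p)`. -/
lemma lintegral_Ioo_rpow_sub_rpow {a b p r : ℝ} (ha : 0 < a) (hb : 0 < b) (hp : 0 < p)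
    (hr : 0 < r) (hr1 : r < 1) :
    ∫⁻ t in Ioo r 1,
        ENNReal.ofReal (t ^ (p - 1) * (t ^ p - r ^ p) ^ (a - 1) * (1 - t ^ p) ^ (b - 1)) =
      ENNReal.ofReal (p⁻¹ * beta a b * (1 - r ^ p) ^ (a + b - 1)) := by
  have hrp : 0 < r ^ p := Real.rpow_pos_of_pos hr p
  have hc : 0 < 1 - r ^ p := sub_pos.2 (Real.rpow_lt_one hr.le hr1 hp)
  set c := 1 - r ^ p with hc_def
  have him : (fun t : ℝ => (t ^ p - r ^ p) / c) '' Ioo r 1 = Ioo 0 1 := by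
    ext v
    constructor
    · rintro ⟨t, ⟨h1, h2⟩, rfl⟩
      have h3 : r ^ p < t ^ p := Real.rpow_lt_rpow hr.le h1 hp
      have h4 : t ^ p < 1 := Real.rpow_lt_one (hr.trans h1).le h2 hp
      exact ⟨div_pos (sub_pos.2 h3) hc, (div_lt_one hc).2 (by linarith)⟩
    · rintro ⟨h0, h1⟩
      have hw : r ^ p < r ^ p + v * c := by nlinarith [mul_pos h0 hc]
      have hw1 : r ^ p + v * c < 1 := by nlinarith
      have hw0 : 0 < r ^ p + v * c := hrp.trans hw
      refine ⟨(r ^ p + v * c) ^ p⁻¹, ⟨?_, ?_⟩, ?_⟩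
      · exact (Real.lt_rpow_inv_iff_of_pos hr.le hw0.le hp).2 hw
      · exact Real.rpow_lt_one hw0.le hw1 (inv_pos.2 hp)
      · simp only
        rw [Real.rpow_inv_rpow hw0.le hp.ne']
        field_simp
        ring
  have hderiv : ∀ t ∈ Ioo r 1, HasDerivWithinAt (fun t : ℝ => (t ^ p - r ^ p) / c)
      (p * t ^ (p - 1) / c) (Ioo r 1) t := fun t ht =>
    (((Real.hasDerivAt_rpow_const (Or.inl (hr.trans ht.1).ne')).sub_const _).div_const
      c).hasDerivWithinAt
  have hinj : InjOn (fun t : ℝ => (t ^ p - r ^ p) / c) (Ioo r 1) := by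
    intro t ht u hu h
    have h' : t ^ p = u ^ p := by
      have := (div_left_inj' hc.ne').1 h
      linarith
    exact (Real.rpow_left_inj (hr.trans ht.1).le (hr.trans hu.1).le hp.ne').1 h'
  have key := lintegral_image_eq_lintegral_abs_deriv_mul measurableSet_Ioo hderiv hinj
    (fun v => ENNReal.ofReal (v ^ (a - 1) * (1 - v) ^ (b - 1)))
  rw [him, lintegral_Ioo_rpow_mul_one_sub_rpow ha hb] at key
  have hpt : ∀ t ∈ Ioo r 1,
      ENNReal.ofReal (t ^ (p - 1) * (t ^ p - r ^ p) ^ (a - 1) * (1 - t ^ p) ^ (b - 1)) =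
        ENNReal.ofReal (p⁻¹ * c ^ (a + b - 1)) *
          (ENNReal.ofReal |p * t ^ (p - 1) / c| *
            ENNReal.ofReal (((t ^ p - r ^ p) / c) ^ (a - 1) *
              (1 - (t ^ p - r ^ p) / c) ^ (b - 1))) := by
    intro t ht
    have ht0 : 0 < t := hr.trans ht.1
    have h3 : 0 < t ^ p - r ^ p := sub_pos.2 (Real.rpow_lt_rpow hr.le ht.1 hp)
    have h4 : 0 < 1 - t ^ p := sub_pos.2 (Real.rpow_lt_one ht0.le ht.2 hp)
    have h5 : 1 - (t ^ p - r ^ p) / c = (1 - t ^ p) / c := by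
      field_simp
      rw [hc_def]
      ring
    rw [abs_of_pos (by positivity), ← ENNReal.ofReal_mul (by positivity),
      ← ENNReal.ofReal_mul (by positivity), h5, Real.div_rpow h3.le hc.le,
      Real.div_rpow h4.le hc.le,
      show a + b - 1 = (a - 1) + (b - 1) + 1 by ring, Real.rpow_add hc, Real.rpow_add hc,
      Real.rpow_one]
    congr 1
    field_simp
  rw [setLIntegral_congr_fun measurableSet_Ioo hpt,
    lintegral_const_mul' _ _ ENNReal.ofReal_ne_top, ← key, ← ENNReal.ofReal_mul (by positivity)]
  congr 1
  ring

lemma Kconst_eq {α β p : ℝ} (h : β < α) (hp : 0 < p) :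
    Kconst α β p = p⁻¹ * Real.Gamma ((α - β) / p) := by
  rw [Kconst, integral_rpow_mul_exp_neg_rpow hp (by linarith)]
  congr 1
  · simp
  · congr 2
    ring

lemma Kconst_pos {α β p : ℝ} (h : β < α) (hp : 0 < p) : 0 < Kconst α β p := by
  rw [Kconst_eq h hp]
  exact mul_pos (inv_pos.2 hp) (Real.Gamma_pos_of_pos (div_pos (sub_pos.2 h) hp))

/-- The Lebesgue density of `tauMeasure β α p`. -/
def tauDensity (β α p s : ℝ) : ENNReal :=
  if 0 < s ∧ s < 1 then
    ENNReal.ofReal ((Kconst α β p)⁻¹ * (s ^ (-α - 1) * (1 - s ^ p) ^ ((α - β) / p - 1)))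
  else 0

lemma tauMeasure_eq (β α p : ℝ) :
    tauMeasure β α p = (volume : Measure ℝ).withDensity (tauDensity β α p) := rfl

@[fun_prop]
lemma measurable_tauDensity (β α p : ℝ) : Measurable (tauDensity β α p) :=
  Measurable.ite measurableSet_Ioo (by fun_prop) measurable_const

lemma tauDensity_ne_top (β α p s : ℝ) : tauDensity β α p s ≠ ⊤ := by
  unfold tauDensity
  split_ifs
  · exact ENNReal.ofReal_ne_top
  · exact ENNReal.zero_ne_top

instance sigmaFinite_tauMeasure (β α p : ℝ) : SigmaFinite (tauMeasure β α p) :=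
  SigmaFinite.withDensity_of_ne_top (ae_of_all _ (tauDensity_ne_top β α p))

lemma lintegral_tauMeasure (β α p : ℝ) {g : ℝ → ENNReal} (hg : Measurable g) :
    ∫⁻ s, g s ∂tauMeasure β α p = ∫⁻ s, tauDensity β α p s * g s := by
  rw [tauMeasure_eq, lintegral_withDensity_eq_lintegral_mul _ (measurable_tauDensity β α p) hg]
  rfl

lemma ae_tauMeasure_mem_Ioo (β α p : ℝ) : ∀ᵐ s ∂tauMeasure β α p, s ∈ Ioo (0 : ℝ) 1 := by
  rw [tauMeasure_eq, ae_withDensity_iff (measurable_tauDensity β α p)]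
  refine ae_of_all _ fun s hs => ?_
  by_contra h
  exact hs (if_neg h)

/-- The multiplicative convolution of the densities of `tauMeasure β α p` and
`tauMeasure γ β p` is the density of `tauMeasure γ α p`. -/
lemma lintegral_tauDensity_mul_tauDensity_div {γ β α p : ℝ} (hγβ : γ < β) (hβα : β < α)
    (hp : 0 < p) (r : ℝ) :
    ∫⁻ t, tauDensity γ β p t * (ENNReal.ofReal t⁻¹ * tauDensity β α p (r / t)) =
      tauDensity γ α p r := by
  by_cases hr : 0 < r ∧ r < 1
  · obtain ⟨hr0, hr1⟩ := hr
    have ha : 0 < (α - β) / p := div_pos (sub_pos.2 hβα) hp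
    have hb : 0 < (β - γ) / p := div_pos (sub_pos.2 hγβ) hp
    have hK1 := Kconst_pos hβα hp
    have hK2 := Kconst_pos hγβ hp
    have hc : 0 < 1 - r ^ p := sub_pos.2 (Real.rpow_lt_one hr0.le hr1 hp)
    have hind : ∀ t, tauDensity γ β p t * (ENNReal.ofReal t⁻¹ * tauDensity β α p (r / t)) =
        (Ioo r 1).indicator (fun t => ENNReal.ofReal
          ((Kconst α β p)⁻¹ * (Kconst β γ p)⁻¹ * r ^ (-α - 1)) * ENNReal.ofReal
          (t ^ (p - 1) * (t ^ p - r ^ p) ^ ((α - β) / p - 1) *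
            (1 - t ^ p) ^ ((β - γ) / p - 1))) t := by
      intro t
      by_cases ht : t ∈ Ioo r 1
      · have ht0 : 0 < t := hr0.trans ht.1
        have h3 : 0 < t ^ p - r ^ p := sub_pos.2 (Real.rpow_lt_rpow hr0.le ht.1 hp)
        have h4 : 0 < 1 - t ^ p := sub_pos.2 (Real.rpow_lt_one ht0.le ht.2 hp)
        have htp : 0 < t ^ p := Real.rpow_pos_of_pos ht0 p
        have h5 : 1 - (r / t) ^ p = (t ^ p - r ^ p) / t ^ p := by
          rw [Real.div_rpow hr0.le ht0.le]
          field_simp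
        have h6 : t ^ (-β - 1) * t⁻¹ * (t ^ (-α - 1))⁻¹ * ((t ^ p) ^ ((α - β) / p - 1))⁻¹ =
            t ^ (p - 1) := by
          rw [← Real.rpow_neg_one t, ← Real.rpow_mul ht0.le, ← Real.rpow_neg ht0.le,
            ← Real.rpow_neg ht0.le, ← Real.rpow_add ht0, ← Real.rpow_add ht0,
            ← Real.rpow_add ht0]
          congr 1
          field_simp
          ring
        rw [indicator_of_mem ht, tauDensity, tauDensity, if_pos ⟨ht0, ht.2⟩,
          if_pos ⟨div_pos hr0 ht0, (div_lt_one ht0).2 ht.1⟩, h5,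
          ← ENNReal.ofReal_mul (by positivity), ← ENNReal.ofReal_mul (by positivity),
          ← ENNReal.ofReal_mul (by positivity), Real.div_rpow hr0.le ht0.le,
          Real.div_rpow h3.le htp.le, ← h6]
        congr 1
        ring
      · rw [indicator_of_notMem ht]
        by_cases h1 : 0 < t ∧ t < 1
        · have h2 : ¬(0 < r / t ∧ r / t < 1) := fun h =>
            ht ⟨(div_lt_one h1.1).1 h.2, h1.2⟩
          simp [tauDensity, h2]
        · simp [tauDensity, h1]
    simp_rw [hind]
    rw [lintegral_indicator measurableSet_Ioo, lintegral_const_mul' _ _ ENNReal.ofReal_ne_top,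
      lintegral_Ioo_rpow_sub_rpow ha hb hp hr0 hr1, tauDensity, if_pos ⟨hr0, hr1⟩,
      ← ENNReal.ofReal_mul (by positivity)]
    have hab : (α - β) / p + (β - γ) / p = (α - γ) / p := by ring
    have hΓ1 := Real.Gamma_pos_of_pos ha
    have hΓ2 := Real.Gamma_pos_of_pos hb
    have hΓ3 := Real.Gamma_pos_of_pos (div_pos (sub_pos.2 (hγβ.trans hβα)) hp)
    rw [beta, hab, Kconst_eq hβα hp, Kconst_eq hγβ hp, Kconst_eq (hγβ.trans hβα) hp]
    congr 1
    field_simp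
  · rw [tauDensity, if_neg hr, lintegral_eq_zero_iff (by fun_prop)]
    refine ae_of_all _ fun t => ?_
    by_cases h1 : 0 < t ∧ t < 1
    · have h2 : ¬(0 < r / t ∧ r / t < 1) := fun h => by
        have h3 : 0 < r := (div_pos_iff_of_pos_right h1.1).1 h.1
        exact hr ⟨h3, ((div_lt_one h1.1).1 h.2).trans h1.2⟩
      simp [tauDensity, h2]
    · simp [tauDensity, h1]

lemma lintegral_mul_comp_mul_right {f g : ℝ → ENNReal} (hf : Measurable f) (hg : Measurable g)
    {t : ℝ} (ht : 0 < t) :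
    ∫⁻ s, f s * g (s * t) = ∫⁻ r, ENNReal.ofReal t⁻¹ * f (r / t) * g r := by
  have h := Real.map_volume_mul_right ht.ne'
  calc ∫⁻ s, f s * g (s * t) = ∫⁻ s, f (s * t / t) * g (s * t) := by
        simp_rw [mul_div_cancel_right₀ _ ht.ne']
    _ = ∫⁻ r, f (r / t) * g r ∂(Measure.map (· * t) volume) :=
        (lintegral_map (f := fun r => f (r / t) * g r) (by fun_prop) (by fun_prop)).symm
    _ = ∫⁻ r, ENNReal.ofReal t⁻¹ * f (r / t) * g r := by
        rw [h, lintegral_smul_measure, smul_eq_mul, abs_of_pos (inv_pos.2 ht),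
          ← lintegral_const_mul' _ _ ENNReal.ofReal_ne_top]
        simp_rw [mul_assoc]

/-- `tauMeasure γ α p` is the multiplicative convolution of `tauMeasure β α p` and
`tauMeasure γ β p`. -/
lemma lintegral_lintegral_tauMeasure {γ β α p : ℝ} (hγβ : γ < β) (hβα : β < α) (hp : 0 < p)
    {g : ℝ → ENNReal} (hg : Measurable g) :
    ∫⁻ s, ∫⁻ t, g (s * t) ∂tauMeasure γ β p ∂tauMeasure β α p =
      ∫⁻ r, g r ∂tauMeasure γ α p := by
  have hpt : ∀ t, tauDensity γ β p t * ∫⁻ s, tauDensity β α p s * g (s * t) =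
      ∫⁻ r, tauDensity γ β p t * (ENNReal.ofReal t⁻¹ * tauDensity β α p (r / t)) * g r := by
    intro t
    by_cases ht : 0 < t
    · rw [lintegral_mul_comp_mul_right (by fun_prop) hg ht,
        ← lintegral_const_mul' _ _ (tauDensity_ne_top γ β p t)]
      simp_rw [mul_assoc]
    · have h0 : tauDensity γ β p t = 0 := if_neg fun h => ht h.1
      simp [h0]
  calc ∫⁻ s, ∫⁻ t, g (s * t) ∂tauMeasure γ β p ∂tauMeasure β α p
      = ∫⁻ t, ∫⁻ s, g (s * t) ∂tauMeasure β α p ∂tauMeasure γ β p :=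
        lintegral_lintegral_swap (by unfold Function.uncurry; fun_prop)
    _ = ∫⁻ t, tauDensity γ β p t * ∫⁻ s, tauDensity β α p s * g (s * t) := by
        rw [lintegral_tauMeasure _ _ _ (Measurable.lintegral_prod_left (by fun_prop))]
        refine lintegral_congr fun t => ?_
        rw [lintegral_tauMeasure _ _ _ (by fun_prop)]
    _ = ∫⁻ t, ∫⁻ r, tauDensity γ β p t *
          (ENNReal.ofReal t⁻¹ * tauDensity β α p (r / t)) * g r := lintegral_congr hpt
    _ = ∫⁻ r, ∫⁻ t, tauDensity γ β p t *
          (ENNReal.ofReal t⁻¹ * tauDensity β α p (r / t)) * g r :=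
        lintegral_lintegral_swap (by unfold Function.uncurry; fun_prop)
    _ = ∫⁻ r, tauDensity γ α p r * g r := by
        refine lintegral_congr fun r => ?_
        rw [lintegral_mul_const _ (by fun_prop),
          lintegral_tauDensity_mul_tauDensity_div hγβ hβα hp]
    _ = ∫⁻ r, g r ∂tauMeasure γ α p := (lintegral_tauMeasure _ _ _ hg).symm

lemma isLevyMeasure_of_lintegral_lt_top {F : Type*} [NormedAddCommGroup F] [MeasurableSpace F]
    [BorelSpace F] {M : Measure F} (h0 : M {0} = 0)
    (h : ∫⁻ x, ENNReal.ofReal (min (‖x‖ ^ 2) 1) ∂M < ⊤) : IsLevyMeasure M := by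
  refine ⟨?_, h0, h⟩
  let A : ℕ → Set F := fun n => {x | ((n : ENNReal) + 1)⁻¹ ≤ ENNReal.ofReal (min (‖x‖ ^ 2) 1)}
  refine Measure.sigmaFinite_of_countable (S := insert {0} (range A))
    ((countable_range A).insert _) ?_ ?_
  · rintro s (rfl | ⟨n, rfl⟩)
    · simp [h0]
    · refine (meas_ge_le_lintegral_div (by fun_prop) (by simp) (by simp)).trans_lt ?_
      exact ENNReal.div_lt_top h.ne (by simp)
  · refine eq_univ_of_forall fun x => ?_
    by_cases hx : x = 0
    · exact ⟨{0}, mem_insert _ _, hx⟩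
    · have hpos : ENNReal.ofReal (min (‖x‖ ^ 2) 1) ≠ 0 := by
        rw [← pos_iff_ne_zero, ENNReal.ofReal_pos]
        exact lt_min (by positivity) one_pos
      obtain ⟨n, hn⟩ := ENNReal.exists_inv_nat_lt hpos
      refine ⟨A n, mem_insert_of_mem _ ⟨n, rfl⟩, le_trans ?_ hn.le⟩
      exact ENNReal.inv_le_inv.2 le_self_add

section Upsilon

variable {F : Type*} [NormedAddCommGroup F] [NormedSpace ℝ F] [MeasurableSpace F] [BorelSpace F]
  [SecondCountableTopology F]

instance sFinite_Upsilon (ρ : Measure ℝ) (M : Measure F) [SFinite ρ] [SFinite M] :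
    SFinite (Upsilon ρ M) := by
  unfold Upsilon
  infer_instance

lemma lintegral_Upsilon (ρ : Measure ℝ) (M : Measure F) [SFinite M]
    {f : F → ENNReal} (hf : Measurable f) :
    ∫⁻ y, f y ∂Upsilon ρ M = ∫⁻ s, ∫⁻ x, f (s • x) ∂M ∂ρ := by
  rw [Upsilon, lintegral_map hf (by fun_prop), lintegral_prod _ (by fun_prop)]

lemma Upsilon_tauMeasure_comp {γ β α p : ℝ} (hγβ : γ < β) (hβα : β < α) (hp : 0 < p)
    (M : Measure F) [SFinite M] :
    Upsilon (tauMeasure β α p) (Upsilon (tauMeasure γ β p) M) =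
      Upsilon (tauMeasure γ α p) M := by
  refine Measure.ext_of_lintegral _ fun f hf => ?_
  have hg : Measurable fun r : ℝ => ∫⁻ x, f (r • x) ∂M :=
    Measurable.lintegral_prod_right (by fun_prop)
  rw [lintegral_Upsilon _ _ hf, lintegral_Upsilon _ _ hf,
    ← lintegral_lintegral_tauMeasure hγβ hβα hp hg]
  refine lintegral_congr fun s => ?_
  rw [lintegral_Upsilon _ _ (by fun_prop)]
  simp_rw [smul_smul]

lemma Upsilon_tauMeasure_singleton_zero (β α p : ℝ) {M : Measure F} [SFinite M]
    (hM : M {0} = 0) : Upsilon (tauMeasure β α p) M {0} = 0 := by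
  rw [← lintegral_indicator_one (measurableSet_singleton 0),
    lintegral_Upsilon _ _ (measurable_one.indicator (measurableSet_singleton 0)),
    lintegral_congr_ae (g := 0), Pi.zero_def, lintegral_zero]
  filter_upwards [ae_tauMeasure_mem_Ioo β α p] with s hs
  have hx : ∀ x : F, ({0} : Set F).indicator (1 : F → ENNReal) (s • x) =
      ({0} : Set F).indicator 1 x := fun x => by
    have hs0 : s ≠ 0 := hs.1.ne'
    by_cases hx : x = 0 <;> simp [hx, hs0]
  simp_rw [hx]
  exact (lintegral_indicator_one (measurableSet_singleton 0)).trans hM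

/-- If the `tau`-transform of `N` integrates `|x|² ∧ 1`, then so does `N`. -/
lemma lintegral_lt_top_of_Upsilon_tauMeasure {β α p : ℝ} (hβα : β < α) (hp : 0 < p)
    {N : Measure F} [SFinite N]
    (h : ∫⁻ x, ENNReal.ofReal (min (‖x‖ ^ 2) 1) ∂Upsilon (tauMeasure β α p) N < ⊤) :
    ∫⁻ x, ENNReal.ofReal (min (‖x‖ ^ 2) 1) ∂N < ⊤ := by
  rw [lintegral_Upsilon _ _ (by fun_prop)] at h
  set I := ∫⁻ x, ENNReal.ofReal (min (‖x‖ ^ 2) 1) ∂N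
  have hle : (∫⁻ s, ENNReal.ofReal (s ^ 2) ∂tauMeasure β α p) * I < ⊤ := by
    refine lt_of_le_of_lt ?_ h
    rw [← lintegral_mul_const _ (by fun_prop)]
    refine lintegral_mono_ae ?_
    filter_upwards [ae_tauMeasure_mem_Ioo β α p] with s hs
    rw [← lintegral_const_mul' _ _ ENNReal.ofReal_ne_top]
    refine lintegral_mono fun x => ?_
    rw [← ENNReal.ofReal_mul (by positivity), norm_smul, mul_pow, Real.norm_eq_abs, sq_abs]
    refine ENNReal.ofReal_le_ofReal (le_min ?_ ?_)
    · exact mul_le_mul_of_nonneg_left (min_le_left _ _) (sq_nonneg s)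
    · exact mul_le_one₀ (pow_le_one₀ hs.1.le hs.2.le) (by positivity) (min_le_right _ _)
  have hpos : ∫⁻ s, ENNReal.ofReal (s ^ 2) ∂tauMeasure β α p ≠ 0 := by
    intro h0
    rw [lintegral_tauMeasure _ _ _ (by fun_prop), lintegral_eq_zero_iff (by fun_prop)] at h0
    have hnull : volume (Ioo (0 : ℝ) 1) = 0 := by
      refine measure_mono_null (fun s hs => ?_) (ae_iff.1 h0)
      have hs0 : 0 < s := hs.1
      have h1 : 0 < 1 - s ^ p := sub_pos.2 (Real.rpow_lt_one hs.1.le hs.2 hp)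
      have hK := Kconst_pos hβα hp
      have h2 : 0 < tauDensity β α p s := by
        rw [tauDensity, if_pos ⟨hs.1, hs.2⟩, ENNReal.ofReal_pos]
        positivity
      exact mul_ne_zero h2.ne' (ENNReal.ofReal_pos.2 (by positivity)).ne'
    simp at hnull
  exact ENNReal.lt_top_of_mul_ne_top_right hle.ne hpos

end Upsilon

theorem stmt9 (d : ℕ) (hd : 1 ≤ d) (γ β α p : ℝ) (hγβ : γ < β) (hβα : β < α) (hα : α < 2)
    (hp : 0 < p) :
    UpsilonDomain (E := EuclideanSpace ℝ (Fin d)) (tauMeasure γ α p) =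
      {M ∈ UpsilonDomain (tauMeasure γ β p) |
        Upsilon (tauMeasure γ β p) M ∈ UpsilonDomain (tauMeasure β α p)} ∧
    ∀ M ∈ UpsilonDomain (E := EuclideanSpace ℝ (Fin d)) (tauMeasure γ α p),
      Upsilon (tauMeasure β α p) (Upsilon (tauMeasure γ β p) M) =
        Upsilon (tauMeasure γ α p) M := by
  have hcomp : ∀ M : Measure (EuclideanSpace ℝ (Fin d)), IsLevyMeasure M →
      Upsilon (tauMeasure β α p) (Upsilon (tauMeasure γ β p) M) =
        Upsilon (tauMeasure γ α p) M := fun M hM =>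
    have := hM.1
    Upsilon_tauMeasure_comp hγβ hβα hp M
  refine ⟨?_, fun M hM => hcomp M hM.1⟩
  ext M
  constructor
  · rintro ⟨hM, hΥ⟩
    have := hM.1
    rw [← hcomp M hM] at hΥ
    have hN : IsLevyMeasure (Upsilon (tauMeasure γ β p) M) :=
      isLevyMeasure_of_lintegral_lt_top (Upsilon_tauMeasure_singleton_zero γ β p hM.2.1)
        (lintegral_lt_top_of_Upsilon_tauMeasure hβα hp hΥ.2.2)
    exact ⟨⟨hM, hN⟩, hN, hΥ⟩
  · rintro ⟨⟨hM, -⟩, -, hΥ⟩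
    exact ⟨hM, hcomp M hM ▸ hΥ⟩
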